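/- The van der Waerden number w(3,3,2,2,2;5) equals 20. That is, every 5-coloring of {1,...,20} with colors 0, 1, 2, 3, 4 contains a 3-term arithmetic progression of color 0, a 3-term arithmetic progression of color 1, a 2-term arithmetic progression of color 2, a 2-term arithmetic progression of color 3, or a 2-term arithmetic progression of color 4, and 20 is the least positive integer with this property. -/

import Mathlib

/-- `vdwProp r k n` says: every coloring `χ` of `{1,...,n}` with colors `0,...,r-1`
admits, for some color `i < r`, a `k i`-term arithmetic progression
`a, a+d, ..., a+(k i - 1)d` (with `a ≥ 1`, `d ≥ 1`) contained in `{1,...,n}`,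
all of whose elements have color `i`. -/
def vdwProp (r : ℕ) (k : ℕ → ℕ) (n : ℕ) : Prop :=
  ∀ χ : ℕ → ℕ, (∀ x, 1 ≤ x → x ≤ n → χ x < r) →
    ∃ i < r, ∃ a, 1 ≤ a ∧ ∃ d, 1 ≤ d ∧ a + (k i - 1) * d ≤ n ∧
      ∀ t < k i, χ (a + t * d) = i

/-- No three-term arithmetic progression ending at `n` has its first two terms in the set
of positive integers encoded by the bits of `S`, at least for common differences below `10`. -/
def canAdd (S n : ℕ) : Bool :=
  [1, 2, 3, 4, 5, 6, 7, 8, 9].all fun d => !(S.testBit (n - d) && S.testBit (n - 2 * d))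

/-- Backtracking search for a way to extend a pair of disjoint sets `A`, `B` without three-term
arithmetic progressions by the integers `n, ..., n + f - 1`, skipping at most `j` of them. -/
def extensionSearch : ℕ → ℕ → ℕ → ℕ → ℕ → Bool
  | 0, _, _, _, _ => true
  | f + 1, n, A, B, j =>
    (canAdd A n && extensionSearch f (n + 1) (A ||| 1 <<< n) B j) ||
    (canAdd B n && extensionSearch f (n + 1) A (B ||| 1 <<< n) j) ||
    (match j with
      | 0 => false
      | j + 1 => extensionSearch f (n + 1) A B j)

theorem extensionSearch_eq_false : extensionSearch 20 1 0 0 3 = false := by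
  decide +kernel

/-- The bits of `S` encode the integers `x` with `1 ≤ x < n` of color `c`. -/
def Encodes (χ : ℕ → ℕ) (c n S : ℕ) : Prop :=
  ∀ x, S.testBit x = true ↔ 1 ≤ x ∧ x < n ∧ χ x = c

theorem Encodes.insert {χ : ℕ → ℕ} {c n S : ℕ} (h : Encodes χ c n S) (hn : 1 ≤ n)
    (hc : χ n = c) : Encodes χ c (n + 1) (S ||| 1 <<< n) := by
  intro x
  rw [Nat.testBit_or, Bool.or_eq_true, h x, Nat.one_shiftLeft, Nat.testBit_two_pow]
  simp only [decide_eq_true_eq]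
  grind

theorem Encodes.skip {χ : ℕ → ℕ} {c n S : ℕ} (h : Encodes χ c n S) (hc : χ n ≠ c) :
    Encodes χ c (n + 1) S := by
  intro x
  rw [h x]
  grind

theorem Encodes.canAdd {χ : ℕ → ℕ} {c n S : ℕ} (h : Encodes χ c n S)
    (hc : χ n = c) (hn : n ≤ 20)
    (hfree : ∀ a d, 1 ≤ a → 1 ≤ d → a + 2 * d ≤ 20 →
      ¬ (χ a = c ∧ χ (a + d) = c ∧ χ (a + 2 * d) = c)) : canAdd S n = true := by
  rw [_root_.canAdd, List.all_eq_true]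
  intro d hd
  have hd1 : 1 ≤ d := by
    by_contra! h0
    obtain rfl : d = 0 := by omega
    simp at hd
  by_contra hcon
  simp only [Bool.not_eq_true', Bool.not_eq_false, Bool.and_eq_true, h _] at hcon
  obtain ⟨⟨_, _, h1⟩, h2, _, h3⟩ := hcon
  refine hfree (n - 2 * d) d h2 hd1 (by omega) ⟨h3, ?_, ?_⟩
  · rwa [show n - 2 * d + d = n - d by omega]
  · rwa [show n - 2 * d + 2 * d = n by omega]

theorem extensionSearch_eq_true {χ : ℕ → ℕ}
    (hfree : ∀ c < 2, ∀ a d, 1 ≤ a → 1 ≤ d → a + 2 * d ≤ 20 →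
      ¬ (χ a = c ∧ χ (a + d) = c ∧ χ (a + 2 * d) = c)) :
    ∀ f n A B j, 1 ≤ n → n + f = 21 → Encodes χ 0 n A → Encodes χ 1 n B →
      ((Finset.Icc n 20).filter fun x => 2 ≤ χ x).card ≤ j →
      extensionSearch f n A B j = true
  | 0, _, _, _, _, _, _, _, _, _ => rfl
  | f + 1, n, A, B, j, hn, hf, hA, hB, hj => by
    have ih := extensionSearch_eq_true hfree f (n + 1)
    have hsub : ((Finset.Icc (n + 1) 20).filter fun x => 2 ≤ χ x) ⊆
        (Finset.Icc n 20).filter fun x => 2 ≤ χ x := by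
      intro x
      simp only [Finset.mem_filter, Finset.mem_Icc]
      omega
    have hle := Finset.card_le_card hsub
    simp only [extensionSearch, Bool.or_eq_true, Bool.and_eq_true]
    rcases (by omega : χ n = 0 ∨ χ n = 1 ∨ 2 ≤ χ n) with h | h | h
    · exact Or.inl <| Or.inl ⟨hA.canAdd h (by omega) (hfree 0 (by omega)),
        ih _ _ _ (by omega) (by omega) (hA.insert hn h) (hB.skip (by omega)) (by omega)⟩
    · exact Or.inl <| Or.inr ⟨hB.canAdd h (by omega) (hfree 1 (by omega)),
        ih _ _ _ (by omega) (by omega) (hA.skip (by omega)) (hB.insert hn h) (by omega)⟩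
    · right
      have hlt := Finset.card_lt_card <| (Finset.ssubset_iff_of_subset hsub).2
        ⟨n, by simp only [Finset.mem_filter, Finset.mem_Icc]; omega,
          by simp only [Finset.mem_filter, Finset.mem_Icc]; omega⟩
      cases j with
      | zero => omega
      | succ j =>
        exact ih _ _ _ (by omega) (by omega) (hA.skip (by omega)) (hB.skip (by omega)) (by omega)

theorem vdwProp_twenty : vdwProp 5 (fun i => [3, 3, 2, 2, 2].getD i 0) 20 := by
  intro χ hχ
  by_contra hcon
  have hfree : ∀ c < 2, ∀ a d, 1 ≤ a → 1 ≤ d → a + 2 * d ≤ 20 →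
      ¬ (χ a = c ∧ χ (a + d) = c ∧ χ (a + 2 * d) = c) := by
    rintro c hc a d ha hd had ⟨h0, h1, h2⟩
    have hk : [3, 3, 2, 2, 2].getD c 0 = 3 := by interval_cases c <;> rfl
    refine hcon ⟨c, by omega, a, ha, d, hd, ?_, ?_⟩
    · simpa only [hk] using had
    · simp only [hk]
      intro t ht
      interval_cases t
      · simpa using h0
      · simpa using h1
      · exact h2
  have hpair : ∀ x y, 1 ≤ x → x < y → y ≤ 20 → 2 ≤ χ x → χ x ≠ χ y := by
    intro x y hx hxy hy h2 heq
    have h5 := hχ x hx (by omega)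
    have hk : [3, 3, 2, 2, 2].getD (χ x) 0 = 2 := by
      generalize χ x = c at *
      interval_cases c <;> rfl
    refine hcon ⟨χ x, h5, x, hx, y - x, by omega, ?_, ?_⟩
    · simp only [hk]
      omega
    · simp only [hk]
      intro t ht
      interval_cases t
      · simp
      · rw [show x + 1 * (y - x) = y by omega, heq]
  have hcard : ((Finset.Icc 1 20).filter fun x => 2 ≤ χ x).card ≤ 3 := by
    refine Finset.card_le_card_of_injOn χ (t := Finset.Ico 2 5) ?_ ?_
    · intro x hx
      simp only [Finset.coe_filter, Finset.mem_Icc, Set.mem_ofPred_eq] at hx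
      simpa using ⟨hx.2, hχ x hx.1.1 hx.1.2⟩
    · intro x hx y hy hxy
      simp only [Finset.coe_filter, Finset.mem_Icc, Set.mem_ofPred_eq] at hx hy
      rcases lt_trichotomy x y with h | h | h
      · exact absurd hxy (hpair x y hx.1.1 h hy.1.2 hx.2)
      · exact h
      · exact absurd hxy.symm (hpair y x hy.1.1 h hx.1.2 hy.2)
  have hempty : ∀ c, Encodes χ c 1 0 := by
    intro c x
    simp only [Nat.zero_testBit, Bool.false_eq_true, false_iff]
    omega
  have := extensionSearch_eq_true hfree 20 1 0 0 3 le_rfl rfl (hempty 0) (hempty 1) hcard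
  rw [extensionSearch_eq_false] at this
  exact Bool.false_ne_true this

/-- A coloring of `{1, ..., 19}` without the prescribed monochromatic progressions; the entry
at index `0` is irrelevant. -/
def extremalColoring (x : ℕ) : ℕ :=
  [0, 0, 0, 1, 0, 0, 1, 1, 2, 3, 1, 4, 1, 0, 0, 1, 1, 0, 0, 1].getD x 0

theorem extremalColoring_lt (x : ℕ) (hx : x < 20) : extremalColoring x < 5 := by
  revert x
  decide

theorem extremalColoring_avoids : ∀ i < 5, ∀ a ∈ Finset.Icc 1 19, ∀ d ∈ Finset.Icc 1 19,
    a + ([3, 3, 2, 2, 2].getD i 0 - 1) * d ≤ 19 →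
      ¬ ∀ t < [3, 3, 2, 2, 2].getD i 0, extremalColoring (a + t * d) = i := by
  decide +kernel

/-- The van der Waerden number `w(3,3,2,2,2;5)` equals `20`: it is the least positive
integer `n` such that every `5`-coloring of `{1,...,n}` admits a monochromatic
arithmetic progression of the prescribed length in the prescribed color. -/
theorem vdw_value :
    IsLeast {n : ℕ | 0 < n ∧ vdwProp 5 (fun i => [3, 3, 2, 2, 2].getD i 0) n} 20 := by
  refine ⟨⟨by norm_num, vdwProp_twenty⟩, ?_⟩
  rintro n ⟨-, hn⟩
  by_contra! hlt
  obtain ⟨i, hi, a, ha, d, hd, hle, hmono⟩ :=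
    hn extremalColoring fun x _ hx => extremalColoring_lt x (by omega)
  have hk : 2 ≤ [3, 3, 2, 2, 2].getD i 0 := by interval_cases i <;> decide
  have hdle : d ≤ ([3, 3, 2, 2, 2].getD i 0 - 1) * d :=
    Nat.le_mul_of_pos_left d (by omega)
  have hle' : a + ([3, 3, 2, 2, 2].getD i 0 - 1) * d ≤ n := hle
  exact extremalColoring_avoids i hi a (Finset.mem_Icc.2 ⟨ha, by omega⟩) d
    (Finset.mem_Icc.2 ⟨hd, by omega⟩) (by omega) hmono
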